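/- Let n ≥ 2, let Ω be a domain (open connected set) in ℝⁿ, let 0 < δ ≤ n, 0 ≤ κ < 1, and δ/n < p < δ. Then there exists a constant c depending only on n, δ, κ, and p such that ( ∫_Ω |u(x)|^{p(δ−κp)/(δ−p)} dH^{δ−κp}_∞ )^{(δ−p)/(p(δ−κp))} ≤ c ( ∫_Ω |∇u(x)|^p dH^δ_∞ )^{1/p} for all u ∈ C¹_0(Ω) (continuously differentiable functions with compact support in Ω). -/

import Mathlib

open MeasureTheory Metric Set Bornology
open scoped ENNReal NNReal

/-- The `δ`-dimensional Hausdorff content of a set `E ⊆ ℝⁿ`, defined as the infimum of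
`∑ᵢ rᵢ^δ` over all countable coverings of `E` by open balls `B(xᵢ, rᵢ)`. -/
noncomputable def hContent (n : ℕ) (δ : ℝ) (E : Set (EuclideanSpace ℝ (Fin n))) : ℝ≥0∞ :=
  ⨅ (x : ℕ → EuclideanSpace ℝ (Fin n)) (r : ℕ → ℝ≥0)
    (_ : E ⊆ ⋃ i, Metric.ball (x i) (r i)), ∑' i, (r i : ℝ≥0∞) ^ δ

/-- The `δ`-dimensional Hausdorff measure of `E ⊆ ℝⁿ`, obtained from coverings by open balls of
radii at most `ρ`, in the limit `ρ → 0⁺` (equivalently: the supremum over `ρ > 0`, since the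
infima increase as `ρ` decreases). -/
noncomputable def hMeasure (n : ℕ) (δ : ℝ) (E : Set (EuclideanSpace ℝ (Fin n))) : ℝ≥0∞ :=
  ⨆ (ρ : ℝ≥0) (_ : 0 < ρ),
    ⨅ (x : ℕ → EuclideanSpace ℝ (Fin n)) (r : ℕ → ℝ≥0)
      (_ : E ⊆ ⋃ i, Metric.ball (x i) (r i)) (_ : ∀ i, r i ≤ ρ), ∑' i, (r i : ℝ≥0∞) ^ δ

/-- The Choquet integral `∫_Ω f dH^δ_∞ = ∫₀^∞ H^δ_∞({x ∈ Ω : f x > t}) dt` of a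
(nonnegative) real-valued function with respect to the Hausdorff content. -/
noncomputable def choquet (n : ℕ) (δ : ℝ) (Ω : Set (EuclideanSpace ℝ (Fin n)))
    (f : EuclideanSpace ℝ (Fin n) → ℝ) : ℝ≥0∞ :=
  ∫⁻ t in Set.Ioi (0 : ℝ), hContent n δ {x ∈ Ω | t < f x}

/-- The Choquet integral of an `[0,∞]`-valued function with respect to the Hausdorff content. -/
noncomputable def echoquet (n : ℕ) (δ : ℝ) (Ω : Set (EuclideanSpace ℝ (Fin n)))
    (f : EuclideanSpace ℝ (Fin n) → ℝ≥0∞) : ℝ≥0∞ :=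
  ∫⁻ t in Set.Ioi (0 : ℝ), hContent n δ {x ∈ Ω | ENNReal.ofReal t < f x}

/-- The centered fractional Hardy–Littlewood maximal function
`M_κ f (x) = sup_{r>0} r^{κ-n} ∫_{B(x,r)} |f|`. -/
noncomputable def fracMaximal (n : ℕ) (κ : ℝ) (f : EuclideanSpace ℝ (Fin n) → ℝ)
    (x : EuclideanSpace ℝ (Fin n)) : ℝ≥0∞ :=
  ⨆ (r : ℝ) (_ : 0 < r),
    ENNReal.ofReal (r ^ (κ - n)) * ∫⁻ y in Metric.ball x r, ENNReal.ofReal |f y|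

/-- The Riesz potential of order `1`: `I₁ f (x) = ∫_{ℝⁿ} |f y| / |x-y|^{n-1} dy`. -/
noncomputable def rieszPot (n : ℕ) (f : EuclideanSpace ℝ (Fin n) → ℝ)
    (x : EuclideanSpace ℝ (Fin n)) : ℝ≥0∞ :=
  ∫⁻ y, ENNReal.ofReal |f y| / edist x y ^ ((n : ℝ) - 1)

/-- `Ω` is an `(α, β)`-John domain with John center `x₀`: every `x ∈ Ω` can be joined to `x₀`
by a rectifiable curve `γ : [0, L] → Ω` parametrized by arclength (hence `1`-Lipschitz) with
`γ 0 = x`, `γ L = x₀`, `L ≤ β` and `dist (γ t, ∂Ω) ≥ (α/β) t`. -/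
def IsJohnDomainWithCenter (n : ℕ) (α β : ℝ) (Ω : Set (EuclideanSpace ℝ (Fin n)))
    (x₀ : EuclideanSpace ℝ (Fin n)) : Prop :=
  x₀ ∈ Ω ∧ ∀ x ∈ Ω, ∃ L : ℝ, 0 ≤ L ∧ L ≤ β ∧ ∃ γ : ℝ → EuclideanSpace ℝ (Fin n),
    γ 0 = x ∧ γ L = x₀ ∧ (∀ t ∈ Set.Icc 0 L, γ t ∈ Ω) ∧
    LipschitzOnWith 1 γ (Set.Icc 0 L) ∧
    ∀ t ∈ Set.Icc 0 L, α / β * t ≤ Metric.infDist (γ t) (frontier Ω)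

/-- `Ω` is an `(α, β)`-John domain. -/
def IsJohnDomain (n : ℕ) (α β : ℝ) (Ω : Set (EuclideanSpace ℝ (Fin n))) : Prop :=
  ∃ x₀, IsJohnDomainWithCenter n α β Ω x₀

theorem ENNReal.tsum_rpow_le_tsum_rpow {ι : Type*} (f : ι → ℝ≥0∞) {α : ℝ} (hα : 1 ≤ α) :
    ∑' i, f i ^ α ≤ (∑' i, f i) ^ α := by
  rcases eq_or_ne (∑' i, f i) ∞ with h | h
  · rw [h, ENNReal.top_rpow_of_pos (by linarith)]
    exact le_top
  have split : ∀ a : ℝ≥0∞, a ^ α = a * a ^ (α - 1) := fun a => by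
    conv_lhs => rw [show α = 1 + (α - 1) by ring,
      ENNReal.rpow_add_of_nonneg _ _ zero_le_one (by linarith), ENNReal.rpow_one]
  calc ∑' i, f i ^ α ≤ ∑' i, f i * (∑' j, f j) ^ (α - 1) := by
        refine ENNReal.tsum_le_tsum fun i => ?_
        rw [split]
        exact mul_le_mul_right (ENNReal.rpow_le_rpow (ENNReal.le_tsum i) (by linarith)) _
    _ = (∑' i, f i) ^ α := by rw [ENNReal.tsum_mul_right, ← split]

theorem hContent_le_tsum {n : ℕ} {d : ℝ} (hd : 0 < d) {ι : Type*} [Countable ι]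
    {E : Set (EuclideanSpace ℝ (Fin n))} (x : ι → EuclideanSpace ℝ (Fin n)) (r : ι → ℝ≥0)
    (hE : E ⊆ ⋃ i, ball (x i) (r i)) : hContent n d E ≤ ∑' i, (r i : ℝ≥0∞) ^ d := by
  obtain ⟨g, hg⟩ := exists_injective_nat ι
  refine (iInf₂_le (Function.extend g x 0) (Function.extend g r 0)).trans
    ((iInf_le _ ?_).trans (le_of_eq ?_))
  · refine hE.trans (iUnion_subset fun i => ?_)
    refine subset_iUnion_of_subset (g i) ?_
    rw [hg.extend_apply, hg.extend_apply]
  · rw [← tsum_extend_zero hg]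
    refine tsum_congr fun k => ?_
    by_cases hk : ∃ i, g i = k
    · obtain ⟨i, rfl⟩ := hk
      simp [hg.extend_apply]
    · simp [Function.extend_apply' _ _ _ hk, hd]

theorem hContent_mono {n : ℕ} {d : ℝ} {E F : Set (EuclideanSpace ℝ (Fin n))} (h : E ⊆ F) :
    hContent n d E ≤ hContent n d F :=
  iInf_mono fun _ => iInf_mono fun _ => le_iInf fun hF => iInf_le_of_le (h.trans hF) le_rfl

theorem exists_cover_of_hContent_lt {n : ℕ} {d : ℝ} {E : Set (EuclideanSpace ℝ (Fin n))}
    {a : ℝ≥0∞} (h : hContent n d E < a) :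
    ∃ (x : ℕ → EuclideanSpace ℝ (Fin n)) (r : ℕ → ℝ≥0),
      E ⊆ ⋃ i, ball (x i) (r i) ∧ ∑' i, (r i : ℝ≥0∞) ^ d < a := by
  simp only [hContent, iInf_lt_iff] at h
  obtain ⟨x, r, hE, hlt⟩ := h
  exact ⟨x, r, hE, hlt⟩

theorem lintegral_hContent_le_tsum {n : ℕ} {d : ℝ} (hd : 0 < d) {ι : Type*} [Countable ι]
    (E : ℝ → Set (EuclideanSpace ℝ (Fin n))) (x : ι → EuclideanSpace ℝ (Fin n)) (r : ι → ℝ≥0)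
    (D : ι → ℝ) (hE : ∀ t > 0, E t ⊆ ⋃ (i : ι) (_ : t < D i), ball (x i) (r i)) :
    ∫⁻ t in Ioi (0 : ℝ), hContent n d (E t) ≤
      ∑' i, ENNReal.ofReal (D i) * (r i : ℝ≥0∞) ^ d := by
  classical
  calc ∫⁻ t in Ioi (0 : ℝ), hContent n d (E t)
      ≤ ∫⁻ t in Ioi (0 : ℝ), ∑' i, (Iio (D i)).indicator (fun _ => (r i : ℝ≥0∞) ^ d) t := by
        refine setLIntegral_mono' measurableSet_Ioi fun t ht => ?_
        refine (hContent_le_tsum hd x (fun i => if t < D i then r i else 0) ?_).trans ?_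
        · refine (hE t ht).trans (iUnion_mono fun i => iUnion_subset fun h => ?_)
          simp [h]
        · refine ENNReal.tsum_le_tsum fun i => ?_
          by_cases h : t < D i <;> simp [h, hd]
    _ = ∑' i, ∫⁻ t in Ioi (0 : ℝ), (Iio (D i)).indicator (fun _ => (r i : ℝ≥0∞) ^ d) t :=
        lintegral_tsum fun i => (measurable_const.indicator measurableSet_Iio).aemeasurable
    _ = ∑' i, ENNReal.ofReal (D i) * (r i : ℝ≥0∞) ^ d := by
        refine tsum_congr fun i => ?_
        rw [lintegral_indicator_const measurableSet_Iio, Measure.restrict_apply measurableSet_Iio,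
          Iio_inter_Ioi, Real.volume_Ioo, sub_zero, mul_comm]

theorem volume_unitBall_mul_enorm_le {n : ℕ} (hn : 0 < n) {u : EuclideanSpace ℝ (Fin n) → ℝ}
    (hu : ContDiff ℝ 1 u) (hc : HasCompactSupport u) (x : EuclideanSpace ℝ (Fin n)) :
    volume (ball (0 : EuclideanSpace ℝ (Fin n)) 1) * ‖u x‖ₑ ≤
      ∫⁻ s in Ioi (0 : ℝ), ∫⁻ z in ball (0 : EuclideanSpace ℝ (Fin n)) 1,
        ‖fderiv ℝ u (x + s • z)‖ₑ := by
  have : Nonempty (Fin n) := ⟨⟨0, hn⟩⟩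
  have hcont : Continuous (fderiv ℝ u) := hu.continuous_fderiv one_ne_zero
  rw [lintegral_lintegral_swap, mul_comm, ← setLIntegral_const]
  · refine lintegral_mono_ae ?_
    have h0 : ∀ᵐ z : EuclideanSpace ℝ (Fin n) ∂(volume.restrict (ball 0 1)), z ≠ 0 :=
      ae_restrict_of_ae (Measure.ae_ne volume 0)
    filter_upwards [h0, ae_restrict_mem measurableSet_ball] with z hz hz1
    have hline : ∀ s, HasDerivAt (fun s : ℝ => x + s • z) z s := fun s => by
      simpa using ((hasDerivAt_id s).smul_const z).const_add x
    have hg : ContDiff ℝ 1 (fun s : ℝ => u (x + s • z)) :=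
      hu.comp (contDiff_const.add (contDiff_id.smul contDiff_const))
    have hemb : Topology.IsClosedEmbedding (fun s : ℝ => x + s • z) :=
      (Homeomorph.addLeft x).isClosedEmbedding.comp (isClosedEmbedding_smul_left hz)
    have hgc : HasCompactSupport (fun s : ℝ => u (x + s • z)) := hc.comp_isClosedEmbedding hemb
    have hderiv : ∀ s, deriv (fun s : ℝ => u (x + s • z)) s = fderiv ℝ u (x + s • z) z := fun s =>
      (((hu.differentiable one_ne_zero) _).hasFDerivAt.comp_hasDerivAt s (hline s)).deriv
    have key := hgc.integral_Ioi_deriv_eq hg 0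
    simp only [zero_smul, add_zero] at key
    calc ‖u x‖ₑ = ‖∫ s in Ioi (0 : ℝ), deriv (fun s : ℝ => u (x + s • z)) s‖ₑ := by
          rw [key, enorm_neg]
      _ ≤ ∫⁻ s in Ioi (0 : ℝ), ‖deriv (fun s : ℝ => u (x + s • z)) s‖ₑ :=
          enorm_integral_le_lintegral_enorm _
      _ ≤ ∫⁻ s in Ioi (0 : ℝ), ‖fderiv ℝ u (x + s • z)‖ₑ := by
          refine lintegral_mono fun s => ?_
          rw [hderiv]
          refine (ContinuousLinearMap.le_opENorm _ _).trans ?_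
          refine mul_le_of_le_one_right' ?_
          rw [← ofReal_norm, ENNReal.ofReal_le_one]
          exact (mem_ball_zero_iff.1 hz1).le
  · refine Continuous.aemeasurable ?_
    simp only [Function.uncurry_def]
    fun_prop

/-- The Lebesgue measure of `E ∩ B(x, s)`, rescaled to the unit ball. -/
noncomputable def ballDensity {n : ℕ} (E : Set (EuclideanSpace ℝ (Fin n)))
    (x : EuclideanSpace ℝ (Fin n)) (s : ℝ) : ℝ≥0∞ :=
  volume (ball (0 : EuclideanSpace ℝ (Fin n)) 1 ∩ {z | x + s • z ∈ E})

theorem ballDensity_le {n : ℕ} (E : Set (EuclideanSpace ℝ (Fin n)))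
    (x : EuclideanSpace ℝ (Fin n)) (s : ℝ) :
    ballDensity E x s ≤ volume (ball (0 : EuclideanSpace ℝ (Fin n)) 1) :=
  measure_mono inter_subset_left

theorem ballDensity_ball_le {n : ℕ} (y : EuclideanSpace ℝ (Fin n)) (r : ℝ≥0)
    (x : EuclideanSpace ℝ (Fin n)) {s : ℝ} (hs : 0 < s) :
    ballDensity (ball y r) x s ≤
      volume (ball (0 : EuclideanSpace ℝ (Fin n)) 1) *
        ((r : ℝ≥0∞) / ENNReal.ofReal s) ^ (n : ℝ) := by
  have hsub : ball (0 : EuclideanSpace ℝ (Fin n)) 1 ∩ {z | x + s • z ∈ ball y r} ⊆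
      ball (s⁻¹ • (y - x)) (s⁻¹ * r) := by
    rintro z ⟨-, hz⟩
    rw [mem_ofPred_eq, mem_ball, dist_eq_norm] at hz
    rw [mem_ball, dist_eq_norm]
    have : z - s⁻¹ • (y - x) = s⁻¹ • (x + s • z - y) := by
      rw [smul_sub, smul_sub, smul_add, smul_smul, inv_mul_cancel₀ hs.ne', one_smul]
      abel
    rw [this, norm_smul, Real.norm_of_nonneg (by positivity)]
    gcongr
  refine (measure_mono hsub).trans ?_
  rcases eq_or_ne r 0 with rfl | hr
  · simp
  have hr' : 0 < r := pos_iff_ne_zero.2 hr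
  have hpos : 0 < s⁻¹ * (r : ℝ) := by positivity
  rw [Measure.addHaar_ball_of_pos _ _ hpos, finrank_euclideanSpace_fin, mul_comm,
    ENNReal.ofReal_pow hpos.le, ENNReal.rpow_natCast, ENNReal.ofReal_mul (by positivity),
    ENNReal.ofReal_inv_of_pos hs, ENNReal.ofReal_coe_nnreal, mul_comm _ (r : ℝ≥0∞), div_eq_mul_inv]

theorem ballDensity_iUnion_ball_le {n : ℕ} {δ : ℝ} (hδ0 : 0 < δ) (hδn : δ ≤ n)
    (y : ℕ → EuclideanSpace ℝ (Fin n)) (r : ℕ → ℝ≥0) (x : EuclideanSpace ℝ (Fin n)) {s : ℝ}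
    (hs : 0 < s) (J : Set ℕ) (hJ : ∀ j, (ball (y j) (r j) ∩ ball x s).Nonempty → j ∈ J) :
    ballDensity (⋃ j, ball (y j) (r j)) x s ≤
      volume (ball (0 : EuclideanSpace ℝ (Fin n)) 1) *
        ((∑' j, J.indicator (fun j => (r j : ℝ≥0∞) ^ δ) j) ^ (1 / δ) /
          ENNReal.ofReal s) ^ (n : ℝ) := by
  have hn : (0 : ℝ) < n := hδ0.trans_le hδn
  calc ballDensity (⋃ j, ball (y j) (r j)) x s
      ≤ ∑' j, volume
          (ball (0 : EuclideanSpace ℝ (Fin n)) 1 ∩ {z | x + s • z ∈ ball (y j) (r j)}) := by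
        refine le_trans (measure_mono ?_) (measure_iUnion_le _)
        rintro z ⟨hz, hz'⟩
        simp only [mem_ofPred_eq, mem_iUnion] at hz' ⊢
        obtain ⟨j, hj⟩ := hz'
        exact ⟨j, hz, hj⟩
    _ ≤ ∑' j, volume (ball (0 : EuclideanSpace ℝ (Fin n)) 1) / ENNReal.ofReal s ^ (n : ℝ) *
          (J.indicator (fun j => (r j : ℝ≥0∞) ^ δ) j) ^ (n / δ) := by
        refine ENNReal.tsum_le_tsum fun j => ?_
        by_cases hj : j ∈ J
        · rw [indicator_of_mem hj, ← ENNReal.rpow_mul, mul_div_cancel₀ _ hδ0.ne']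
          refine (ballDensity_ball_le (y j) (r j) x hs).trans (le_of_eq ?_)
          rw [ENNReal.div_rpow_of_nonneg _ _ hn.le, div_eq_mul_inv, div_eq_mul_inv]
          ring
        · rw [indicator_of_notMem hj, ENNReal.zero_rpow_of_pos (by positivity), mul_zero,
            nonpos_iff_eq_zero]
          convert measure_empty (μ := volume)
          rw [← disjoint_iff_inter_eq_empty, Set.disjoint_left]
          intro z hz hz'
          refine hj (hJ j ⟨x + s • z, hz', ?_⟩)
          rw [mem_ball, dist_eq_norm, add_sub_cancel_left, norm_smul, Real.norm_of_nonneg hs.le]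
          exact mul_lt_of_lt_one_right hs (mem_ball_zero_iff.1 hz)
    _ ≤ volume (ball (0 : EuclideanSpace ℝ (Fin n)) 1) / ENNReal.ofReal s ^ (n : ℝ) *
          (∑' j, J.indicator (fun j => (r j : ℝ≥0∞) ^ δ) j) ^ (n / δ) := by
        rw [ENNReal.tsum_mul_left]
        exact mul_le_mul_right (ENNReal.tsum_rpow_le_tsum_rpow _ ((one_le_div hδ0).2 hδn)) _
    _ = _ := by
        rw [ENNReal.div_rpow_of_nonneg _ _ hn.le, ← ENNReal.rpow_mul, one_div_mul_eq_div,
          ← mul_div_assoc, ENNReal.mul_div_right_comm]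

theorem ofReal_rpow_le_of_lt_ballDensity {n : ℕ} {δ : ℝ} (hδ0 : 0 < δ) (hδn : δ ≤ n)
    (y : ℕ → EuclideanSpace ℝ (Fin n)) (r : ℕ → ℝ≥0) (x : EuclideanSpace ℝ (Fin n)) {s : ℝ}
    (hs : 0 < s) (J : Set ℕ) (hJ : ∀ j, (ball (y j) (r j) ∩ ball x s).Nonempty → j ∈ J)
    {θ : ℝ≥0} (hθ : 0 < θ)
    (h : volume (ball (0 : EuclideanSpace ℝ (Fin n)) 1) * θ <
      ballDensity (⋃ j, ball (y j) (r j)) x s) :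
    ENNReal.ofReal s ^ δ ≤
      (θ : ℝ≥0∞) ^ (-(δ / n)) * ∑' j, J.indicator (fun j => (r j : ℝ≥0∞) ^ δ) j := by
  have hn : (0 : ℝ) < n := hδ0.trans_le hδn
  have h1 := h.trans_le (ballDensity_iUnion_ball_le hδ0 hδn y r x hs J hJ)
  set P := ∑' j, J.indicator (fun j => (r j : ℝ≥0∞) ^ δ) j
  have h2 := (lt_of_mul_lt_mul_left' h1).le
  have hs0 : ENNReal.ofReal s ≠ 0 := by simpa using hs
  have hθ0 : (θ : ℝ≥0∞) ≠ 0 := by simpa using hθ.ne'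
  have h3 : (θ : ℝ≥0∞) ^ (δ / n) ≤ P / ENNReal.ofReal s ^ δ := by
    have := ENNReal.rpow_le_rpow h2 (show 0 ≤ δ / n by positivity)
    rwa [← ENNReal.rpow_mul, mul_div_cancel₀ _ hn.ne', ENNReal.div_rpow_of_nonneg _ _ hδ0.le,
      ← ENNReal.rpow_mul, one_div_mul_cancel hδ0.ne', ENNReal.rpow_one] at this
  have h4 := ENNReal.mul_le_of_le_div h3
  rw [ENNReal.rpow_neg, mul_comm, ← div_eq_mul_inv, ENNReal.le_div_iff_mul_le, mul_comm]
  · exact h4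
  · left; positivity
  · left; exact ENNReal.rpow_ne_top_of_nonneg (by positivity) (by simp)

theorem exists_cover_of_lt_ballDensity {n : ℕ} {δ : ℝ} (hδ0 : 0 < δ) (hδn : δ ≤ n)
    (y : ℕ → EuclideanSpace ℝ (Fin n)) (r : ℕ → ℝ≥0) (hS : ∑' j, (r j : ℝ≥0∞) ^ δ ≠ ∞)
    {θ : ℝ≥0} (hθ : 0 < θ) :
    ∃ (ι : Type) (_ : Countable ι) (z : ι → EuclideanSpace ℝ (Fin n)) (ρ : ι → ℝ≥0),
      ∑' i, (ρ i : ℝ≥0∞) ^ δ ≤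
        (2 ^ δ + 10 ^ δ * (θ : ℝ≥0∞) ^ (-(δ / n))) * ∑' j, (r j : ℝ≥0∞) ^ δ ∧
      ∀ x s, 0 < s → volume (ball (0 : EuclideanSpace ℝ (Fin n)) 1) * θ <
        ballDensity (⋃ j, ball (y j) (r j)) x s → ∃ i, x ∈ ball (z i) (ρ i) ∧ s ≤ ρ i := by
  classical
  have hn : (0 : ℝ) < n := hδ0.trans_le hδn
  let J : EuclideanSpace ℝ (Fin n) × ℝ → Set ℕ := fun a =>
    {j | (ball (y j) (r j)).Nonempty ∧ ball (y j) (r j) ⊆ ball a.1 (3 * a.2)}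
  let t : Set (EuclideanSpace ℝ (Fin n) × ℝ) := {a | 0 < a.2 ∧ ENNReal.ofReal a.2 ^ δ ≤
    (θ : ℝ≥0∞) ^ (-(δ / n)) * ∑' j, (J a).indicator (fun j => (r j : ℝ≥0∞) ^ δ) j}
  set S := ∑' j, (r j : ℝ≥0∞) ^ δ with hSdef
  have hθ0 : (θ : ℝ≥0∞) ≠ 0 := by simpa using hθ.ne'
  have hb : (θ : ℝ≥0∞) ^ (-(δ / n)) ≠ ∞ := by
    rw [ENNReal.rpow_neg]
    exact ENNReal.inv_ne_top.2 (by positivity)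
  have hR : ∀ a ∈ t, a.2 ≤ (((θ : ℝ≥0∞) ^ (-(δ / n)) * S) ^ (1 / δ)).toReal := by
    intro a ha
    have h1 : ENNReal.ofReal a.2 ^ δ ≤ (θ : ℝ≥0∞) ^ (-(δ / n)) * S :=
      ha.2.trans (mul_le_mul_right (ENNReal.tsum_le_tsum fun j => indicator_le_self _ _ _) _)
    rw [← ENNReal.ofReal_le_iff_le_toReal
      (ENNReal.rpow_ne_top_of_nonneg (by positivity) (ENNReal.mul_ne_top hb hS))]
    have h2 := ENNReal.rpow_le_rpow h1 (show 0 ≤ 1 / δ by positivity)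
    rwa [← ENNReal.rpow_mul, mul_one_div_cancel hδ0.ne', ENNReal.rpow_one] at h2
  obtain ⟨v, hvt, hvd, hv⟩ := Vitali.exists_disjoint_subfamily_covering_enlargement
    (fun a : EuclideanSpace ℝ (Fin n) × ℝ => ball a.1 (3 * a.2)) t (fun a => a.2) 2 one_lt_two
    (fun a ha => ha.1.le) _ hR
    (fun a ha => nonempty_ball.2 (by linarith [ha.1]))
  have hvc : v.Countable := hvd.countable_of_isOpen (fun _ _ => isOpen_ball)
    (fun a ha => nonempty_ball.2 (by linarith [(hvt ha).1]))
  have : Countable v := hvc.to_subtype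
  refine ⟨ℕ ⊕ v, inferInstance, Sum.elim y (fun a => a.1.1),
    Sum.elim (fun j => 2 * r j) (fun a => 10 * a.1.2.toNNReal), ?_, ?_⟩
  · rw [Summable.tsum_sum (f := fun i => ((Sum.elim (fun j => 2 * r j)
      (fun a : v => 10 * a.1.2.toNNReal) i : ℝ≥0) : ℝ≥0∞) ^ δ) ENNReal.summable ENNReal.summable]
    simp only [Sum.elim_inl, Sum.elim_inr, ENNReal.coe_mul, ENNReal.mul_rpow_of_nonneg _ _ hδ0.le,
      ENNReal.tsum_mul_left, add_mul, mul_assoc]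
    refine add_le_add (by simp [hSdef]) (mul_le_mul_right ?_ _)
    calc ∑' a : v, ENNReal.ofReal a.1.2 ^ δ
        ≤ ∑' a : v, (θ : ℝ≥0∞) ^ (-(δ / n)) *
            ∑' j, (J a.1).indicator (fun j => (r j : ℝ≥0∞) ^ δ) j :=
          ENNReal.tsum_le_tsum fun a => (hvt a.2).2
      _ = (θ : ℝ≥0∞) ^ (-(δ / n)) *
            ∑' j, ∑' a : v, (J a.1).indicator (fun j => (r j : ℝ≥0∞) ^ δ) j := by
          rw [ENNReal.tsum_mul_left, ENNReal.tsum_comm]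
      _ ≤ (θ : ℝ≥0∞) ^ (-(δ / n)) * S := by
          refine mul_le_mul_right (ENNReal.tsum_le_tsum fun j => ?_) _
          by_cases h : ∃ a : v, j ∈ J a.1
          · obtain ⟨a, ha⟩ := h
            rw [tsum_eq_single a]
            · exact indicator_le_self _ _ _
            · intro b hba
              refine indicator_of_notMem (fun hb => ?_) _
              obtain ⟨w, hw⟩ := ha.1
              exact (Set.disjoint_left.1 (hvd b.2 a.2 fun h => hba (Subtype.ext h)))
                (hb.2 hw) (ha.2 hw)
          · push Not at h
            rw [ENNReal.tsum_eq_zero.2 fun a => indicator_of_notMem (h a) _]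
            exact zero_le
  · intro x s hs hlt
    by_cases hbig : ∃ j, (ball (y j) (r j) ∩ ball x s).Nonempty ∧ s ≤ r j
    · obtain ⟨j, ⟨w, hw1, hw2⟩, hj⟩ := hbig
      refine ⟨Sum.inl j, ?_, ?_⟩
      · simp only [Sum.elim_inl, mem_ball, NNReal.coe_mul, NNReal.coe_ofNat] at hw1 hw2 ⊢
        linarith [dist_triangle_left x (y j) w]
      · simp only [Sum.elim_inl, NNReal.coe_mul, NNReal.coe_ofNat]
        linarith
    · push Not at hbig
      have hxt : (x, s) ∈ t := by
        refine ⟨hs, ofReal_rpow_le_of_lt_ballDensity hδ0 hδn y r x hs (J (x, s)) ?_ hθ hlt⟩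
        intro j hj
        have hlt' := hbig j hj
        obtain ⟨w, hw1, hw2⟩ := hj
        refine ⟨⟨w, hw1⟩, fun w' hw' => ?_⟩
        simp only [mem_ball] at hw1 hw2 hw' ⊢
        linarith [dist_triangle w' (y j) x, dist_triangle_left (y j) x w]
      obtain ⟨b, hbv, ⟨w, hw1, hw2⟩, hsb⟩ := hv _ hxt
      have hb0 := (hvt hbv).1
      replace hsb : s ≤ 2 * b.2 := hsb
      refine ⟨Sum.inr ⟨b, hbv⟩, ?_, ?_⟩
      · simp only [Sum.elim_inr, mem_ball, NNReal.coe_mul, NNReal.coe_ofNat,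
          Real.coe_toNNReal _ hb0.le] at hw1 hw2 ⊢
        linarith [dist_triangle_left x b.1 w]
      · simp only [Sum.elim_inr, NNReal.coe_mul, NNReal.coe_ofNat, Real.coe_toNNReal _ hb0.le]
        linarith

theorem exists_tsum_zpow_mul_le {β : ℝ} (hβ : 1 < β) (V : ℝ≥0) :
    ∃ C : ℝ, 0 < C ∧ ∀ b : ℝ, 0 < b → ∀ w : ℤ → ℝ≥0∞, (∀ k, w k ≤ V) →
      (∀ k, w k ≤ ENNReal.ofReal ((b * 2 ^ (-k)) ^ β)) →
      ∑' k : ℤ, ENNReal.ofReal (2 ^ k) * w k ≤ ENNReal.ofReal (C * b) := by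
  let g : ℤ → ℝ := fun j => 2 ^ j * min (V : ℝ) ((2 * 2 ^ (-j)) ^ β)
  have hg0 : ∀ j, 0 ≤ g j := fun j => by positivity
  have hg : Summable g := by
    refine Summable.of_nat_of_neg ?_ ?_
    · have hq : (2 : ℝ) ^ (1 - β) < 1 := Real.rpow_lt_one_of_one_lt_of_neg one_lt_two (by linarith)
      refine Summable.of_nonneg_of_le (fun j => hg0 _) (fun j => ?_)
        ((summable_geometric_of_lt_one (by positivity) hq).mul_left (2 ^ β))
      refine (mul_le_mul_of_nonneg_left (min_le_right _ _) (by positivity)).trans (le_of_eq ?_)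
      rw [Real.mul_rpow (by positivity) (by positivity), zpow_neg, Real.inv_rpow (by positivity),
        zpow_natCast, ← Real.rpow_natCast, ← Real.rpow_natCast, ← Real.rpow_mul (by positivity),
        ← Real.rpow_mul (by positivity), sub_mul, one_mul, Real.rpow_sub (by positivity),
        mul_comm β (j : ℝ)]
      field_simp
    · refine Summable.of_nonneg_of_le (fun j => hg0 _) (fun j => ?_)
        ((summable_geometric_of_lt_one (by norm_num) (one_half_lt_one (α := ℝ))).mul_left (V : ℝ))
      refine (mul_le_mul_of_nonneg_left (min_le_left _ _) (by positivity)).trans (le_of_eq ?_)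
      rw [zpow_neg, zpow_natCast, one_div, inv_pow, mul_comm]
  refine ⟨∑' j, g j + 1, by
    have h : 0 ≤ ∑' j, g j := tsum_nonneg hg0
    linarith, fun b hb w hwV hwb => ?_⟩
  obtain ⟨K, hK1, hK2⟩ := exists_mem_Ico_zpow hb (one_lt_two (α := ℝ))
  rw [← (Equiv.addRight K).tsum_eq]
  calc ∑' j : ℤ, ENNReal.ofReal (2 ^ (j + K)) * w (j + K)
      ≤ ∑' j : ℤ, ENNReal.ofReal (b * g j) := by
        refine ENNReal.tsum_le_tsum fun j => ?_
        have h1 : w (j + K) ≤ ENNReal.ofReal (min (V : ℝ) ((2 * 2 ^ (-j)) ^ β)) := by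
          rw [ENNReal.ofReal_min, ENNReal.ofReal_coe_nnreal]
          refine le_min (hwV _) ((hwb _).trans (ENNReal.ofReal_le_ofReal ?_))
          refine Real.rpow_le_rpow (by positivity) ?_ (by linarith)
          rw [neg_add, zpow_add₀ two_ne_zero, zpow_neg 2 K]
          rw [zpow_add_one₀ two_ne_zero] at hK2
          have : b * ((2 : ℝ) ^ K)⁻¹ ≤ 2 := by
            rw [mul_inv_le_iff₀ (by positivity)]
            linarith
          calc b * (2 ^ (-j) * ((2 : ℝ) ^ K)⁻¹) = (b * ((2 : ℝ) ^ K)⁻¹) * 2 ^ (-j) := by ring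
            _ ≤ 2 * 2 ^ (-j) := by gcongr
        refine (mul_le_mul_right h1 _).trans ?_
        rw [← ENNReal.ofReal_mul (by positivity)]
        refine ENNReal.ofReal_le_ofReal ?_
        rw [zpow_add₀ two_ne_zero]
        calc (2 : ℝ) ^ j * 2 ^ K * min (V : ℝ) ((2 * 2 ^ (-j)) ^ β) = 2 ^ K * g j := by
              simp only [g]; ring
          _ ≤ b * g j := mul_le_mul_of_nonneg_right hK1 (hg0 j)
    _ = ENNReal.ofReal (b * ∑' j, g j) := by
        rw [← tsum_mul_left,
          ENNReal.ofReal_tsum_of_nonneg (fun j => mul_nonneg hb.le (hg0 j)) (hg.mul_left b)]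
    _ ≤ _ := ENNReal.ofReal_le_ofReal (by nlinarith)

theorem ofReal_le_tsum_zpow (a : ℝ) :
    ENNReal.ofReal a ≤ ∑' k : ℤ, if (2 : ℝ) ^ k < a then ENNReal.ofReal (2 ^ k) else 0 := by
  rcases le_or_gt a 0 with ha | ha
  · simp [ENNReal.ofReal_of_nonpos ha]
  obtain ⟨K, hK1, hK2⟩ := exists_mem_Ioc_zpow ha (one_lt_two (α := ℝ))
  have hinj : Function.Injective fun j : ℕ => K - (j : ℤ) := fun i j h => by simpa using h
  refine le_trans ?_ (ENNReal.tsum_comp_le_tsum_of_injective hinj _)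
  calc ENNReal.ofReal a ≤ ENNReal.ofReal (2 ^ K * 2) := by
        rw [← zpow_add_one₀ two_ne_zero]
        exact ENNReal.ofReal_le_ofReal hK2
    _ = ∑' j : ℕ, ENNReal.ofReal (2 ^ K * (1 / 2) ^ j) := by
        rw [← ENNReal.ofReal_tsum_of_nonneg (fun j => by positivity)
          (summable_geometric_two.mul_left _), tsum_mul_left, tsum_geometric_two]
    _ ≤ _ := by
        refine ENNReal.tsum_le_tsum fun j => ?_
        have h1 : (2 : ℝ) ^ (K - (j : ℤ)) = 2 ^ K * (1 / 2) ^ j := by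
          rw [zpow_sub₀ two_ne_zero, zpow_natCast, one_div, inv_pow, div_eq_mul_inv]
        have h2 : (2 : ℝ) ^ (K - (j : ℤ)) < a :=
          (zpow_le_zpow_right₀ one_le_two (by omega)).trans_lt hK1
        simp only [h2, if_true]
        rw [h1]

theorem lintegral_unitBall_le_tsum_ballDensity {n : ℕ} {F : Type*} [NormedAddCommGroup F]
    (f : EuclideanSpace ℝ (Fin n) → F) (E : ℤ → Set (EuclideanSpace ℝ (Fin n)))
    (hE : ∀ k, IsOpen (E k)) (hfE : ∀ k : ℤ, {y | (2 : ℝ) ^ k < ‖f y‖} ⊆ E k)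
    (x : EuclideanSpace ℝ (Fin n)) (s : ℝ) :
    ∫⁻ z in ball (0 : EuclideanSpace ℝ (Fin n)) 1, ‖f (x + s • z)‖ₑ ≤
      ∑' k : ℤ, ENNReal.ofReal (2 ^ k) * ballDensity (E k) x s := by
  have hmeas : ∀ k, MeasurableSet {z | x + s • z ∈ E k} := fun k =>
    ((hE k).preimage (by fun_prop : Continuous fun z => x + s • z)).measurableSet
  calc ∫⁻ z in ball (0 : EuclideanSpace ℝ (Fin n)) 1, ‖f (x + s • z)‖ₑ
      ≤ ∫⁻ z in ball (0 : EuclideanSpace ℝ (Fin n)) 1,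
          ∑' k : ℤ, {z | x + s • z ∈ E k}.indicator (fun _ => ENNReal.ofReal (2 ^ k)) z := by
        refine lintegral_mono fun z => ?_
        rw [← ofReal_norm]
        refine (ofReal_le_tsum_zpow _).trans (ENNReal.tsum_le_tsum fun k => ?_)
        split_ifs with h
        · rw [indicator_of_mem (show z ∈ {z | x + s • z ∈ E k} from hfE k h)]
        · exact zero_le
    _ = ∑' k : ℤ, ENNReal.ofReal (2 ^ k) * ballDensity (E k) x s := by
        rw [lintegral_tsum fun k => (measurable_const.indicator (hmeas k)).aemeasurable]
        refine tsum_congr fun k => ?_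
        rw [lintegral_indicator_const (hmeas k), Measure.restrict_apply (hmeas k), inter_comm]
        rfl

theorem lintegral_le_of_le_rpow {Φ : ℝ → ℝ≥0∞} {κ e A C R : ℝ} (hκ : κ < 1) (he : 1 < e)
    (hA : 0 ≤ A) (hC : 0 ≤ C) (hR : 0 < R)
    (h1 : ∀ s, 0 < s → Φ s ≤ ENNReal.ofReal (A * R ^ (κ - e) * s ^ (-κ)))
    (h2 : ∀ s, 0 < s → Φ s ≤ ENNReal.ofReal (C * A * s ^ (-e))) :
    ∫⁻ s in Ioi (0 : ℝ), Φ s ≤ ENNReal.ofReal ((1 / (1 - κ) + C / (e - 1)) * A * R ^ (1 - e)) := by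
  have hκ' : 0 < 1 - κ := by linarith
  have he' : 0 < e - 1 := by linarith
  rw [← Ioc_union_Ioi_eq_Ioi hR.le,
    lintegral_union measurableSet_Ioi (Ioc_disjoint_Ioi le_rfl), add_mul, add_mul,
    ENNReal.ofReal_add (by positivity) (by positivity)]
  refine add_le_add ?_ ?_
  · have hint : IntegrableOn (fun s : ℝ => A * R ^ (κ - e) * s ^ (-κ)) (Ioc 0 R) := by
      rw [← intervalIntegrable_iff_integrableOn_Ioc_of_le hR.le]
      exact (intervalIntegral.intervalIntegrable_rpow' (by linarith)).const_mul _
    calc ∫⁻ s in Ioc 0 R, Φ s ≤ ∫⁻ s in Ioc 0 R, ENNReal.ofReal (A * R ^ (κ - e) * s ^ (-κ)) :=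
          setLIntegral_mono' measurableSet_Ioc fun s hs => h1 s hs.1
      _ = ENNReal.ofReal (∫ s in Ioc 0 R, A * R ^ (κ - e) * s ^ (-κ)) := by
          rw [ofReal_integral_eq_lintegral_ofReal hint]
          filter_upwards [ae_restrict_mem measurableSet_Ioc] with s hs
          have := hs.1
          positivity
      _ = _ := by
          rw [← intervalIntegral.integral_of_le hR.le, intervalIntegral.integral_const_mul,
            integral_rpow (Or.inl (by linarith)), Real.zero_rpow (by linarith), sub_zero,
            show -κ + 1 = 1 - κ by ring,
            show R ^ (1 - e) = R ^ (κ - e) * R ^ (1 - κ) by rw [← Real.rpow_add hR]; congr 1; ring]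
          congr 1
          field_simp
  · have hint : IntegrableOn (fun s : ℝ => C * A * s ^ (-e)) (Ioi R) :=
      (integrableOn_Ioi_rpow_of_lt (by linarith) hR).const_mul _
    calc ∫⁻ s in Ioi R, Φ s ≤ ∫⁻ s in Ioi R, ENNReal.ofReal (C * A * s ^ (-e)) :=
          setLIntegral_mono' measurableSet_Ioi fun s hs => h2 s (hR.trans hs)
      _ = ENNReal.ofReal (∫ s in Ioi R, C * A * s ^ (-e)) := by
          rw [ofReal_integral_eq_lintegral_ofReal hint]
          filter_upwards [ae_restrict_mem measurableSet_Ioi] with s hs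
          have : 0 < s := hR.trans hs
          positivity
      _ = _ := by
          rw [integral_const_mul, integral_Ioi_rpow_of_lt (by linarith) hR,
            show -e + 1 = 1 - e by ring, show (1 - e) = -(e - 1) by ring]
          congr 1
          field_simp

theorem tsum_zpow_mul_hContent_le {n : ℕ} {d p : ℝ} (hp : 0 < p)
    (Ω : Set (EuclideanSpace ℝ (Fin n))) (f : EuclideanSpace ℝ (Fin n) → ℝ) :
    ∑' k : ℤ, ENNReal.ofReal (((2 : ℝ) ^ p) ^ k) * hContent n d {x ∈ Ω | (2 : ℝ) ^ k < f x} ≤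
      ENNReal.ofReal (2 ^ p / (2 ^ p - 1)) * choquet n d Ω fun x => f x ^ p := by
  set a : ℝ := 2 ^ p with ha
  have ha1 : 1 < a := Real.one_lt_rpow one_lt_two hp
  have ha0 : 0 < a := by linarith
  have hmono : Monotone fun k : ℤ => a ^ k := zpow_right_mono₀ ha1.le
  have hlow : ∑' k : ℤ, ENNReal.ofReal (a ^ k * ((a - 1) / a)) *
      hContent n d {x ∈ Ω | (2 : ℝ) ^ k < f x} ≤ choquet n d Ω fun x => f x ^ p := by
    calc ∑' k : ℤ, ENNReal.ofReal (a ^ k * ((a - 1) / a)) *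
          hContent n d {x ∈ Ω | (2 : ℝ) ^ k < f x}
        ≤ ∑' k : ℤ, ∫⁻ t in Ico (a ^ (Order.pred k)) (a ^ k),
            hContent n d {x ∈ Ω | t < f x ^ p} := by
          refine ENNReal.tsum_le_tsum fun k => ?_
          have hvol : volume (Ico (a ^ (Order.pred k)) (a ^ k)) =
              ENNReal.ofReal (a ^ k * ((a - 1) / a)) := by
            rw [Real.volume_Ico, Order.pred_eq_sub_one, zpow_sub_one₀ ha0.ne']
            congr 1
            field_simp
          rw [← hvol, mul_comm, ← setLIntegral_const]
          refine setLIntegral_mono' measurableSet_Ico fun t ht =>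
            hContent_mono fun x hx => ⟨hx.1, ?_⟩
          refine ht.2.trans ?_
          have h2 : a ^ k = ((2 : ℝ) ^ k) ^ p := by
            rw [ha, ← Real.rpow_intCast, ← Real.rpow_intCast, ← Real.rpow_mul two_pos.le,
              ← Real.rpow_mul two_pos.le, mul_comm]
          rw [h2]
          exact Real.rpow_lt_rpow (by positivity) hx.2 hp
      _ = ∫⁻ t in ⋃ k : ℤ, Ico (a ^ (Order.pred k)) (a ^ k), hContent n d {x ∈ Ω | t < f x ^ p} :=
          (lintegral_iUnion (fun _ => measurableSet_Ico) hmono.pairwise_disjoint_on_Ico_pred _).symm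
      _ ≤ _ := lintegral_mono_set (iUnion_subset fun k t ht => (zpow_pos ha0 _).trans_le ht.1)
  refine le_trans (le_of_eq ?_) (mul_le_mul_right hlow _)
  rw [← ENNReal.tsum_mul_left]
  refine tsum_congr fun k => ?_
  have : 0 < a - 1 := by linarith
  rw [← mul_assoc, ← ENNReal.ofReal_mul (by positivity)]
  congr 2
  field_simp

theorem le_ofReal_rpow_of_tsum_le {p A : ℝ} (hA : 0 < A) {S : ℤ → ℝ≥0∞}
    (hS : ∑' k : ℤ, ENNReal.ofReal (((2 : ℝ) ^ p) ^ k) * S k ≤ ENNReal.ofReal (A ^ p)) (k : ℤ) :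
    S k ≤ ENNReal.ofReal ((A * 2 ^ (-k)) ^ p) := by
  have h := (ENNReal.le_tsum k).trans hS
  have hpos : 0 < ((2 : ℝ) ^ p) ^ k := by positivity
  have h2 : (A * 2 ^ (-k)) ^ p = A ^ p / ((2 : ℝ) ^ p) ^ k := by
    rw [Real.mul_rpow hA.le (by positivity), ← Real.rpow_intCast, ← Real.rpow_intCast,
      ← Real.rpow_mul two_pos.le, ← Real.rpow_mul two_pos.le, div_eq_mul_inv,
      ← Real.rpow_neg two_pos.le]
    congr 2
    push_cast
    ring
  rw [h2, ENNReal.ofReal_div_of_pos hpos, ENNReal.le_div_iff_mul_le, mul_comm]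
  · exact h
  · left; simpa using hpos
  · left; simp

theorem exists_tsum_ballDensity_le {n : ℕ} {δ p : ℝ} (hδ0 : 0 < δ) (hδn : δ ≤ n)
    (hp : δ / n < p) :
    ∃ C : ℝ, 0 < C ∧ ∀ A : ℝ, 0 < A → ∀ (y : ℤ → ℕ → EuclideanSpace ℝ (Fin n)) (r : ℤ → ℕ → ℝ≥0),
      ∑' k : ℤ, ENNReal.ofReal (((2 : ℝ) ^ p) ^ k) * ∑' j, (r k j : ℝ≥0∞) ^ δ ≤
        ENNReal.ofReal (A ^ p) → ∀ x s, 0 < s →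
      ∑' k : ℤ, ENNReal.ofReal (2 ^ k) * ballDensity (⋃ j, ball (y k j) (r k j)) x s ≤
        ENNReal.ofReal (C * A * s ^ (-(δ / p))) := by
  have hn : (0 : ℝ) < n := hδ0.trans_le hδn
  have hp0 : 0 < p := (by positivity : 0 < δ / n).trans hp
  have hβ : 1 < p * n / δ := by
    rw [one_lt_div hδ0]
    exact (div_lt_iff₀ hn).1 hp
  set B := ball (0 : EuclideanSpace ℝ (Fin n)) 1
  have hV : volume B = ((volume B).toNNReal : ℝ≥0∞) :=
    (ENNReal.coe_toNNReal measure_ball_lt_top.ne).symm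
  set V := (volume B).toNNReal
  have hV0 : 0 < V := ENNReal.toNNReal_pos (measure_ball_pos _ _ one_pos).ne' measure_ball_lt_top.ne
  obtain ⟨C, hC, hsum⟩ := exists_tsum_zpow_mul_le hβ V
  refine ⟨C * (V : ℝ) ^ (δ / (p * n)), by positivity, fun A hA y r hS x s hs => ?_⟩
  have hb : 0 < (V : ℝ) ^ (δ / (p * n)) * (A * s ^ (-(δ / p))) := by positivity
  refine (hsum _ hb _ (fun k => (ballDensity_le _ x s).trans hV.le) fun k => ?_).trans
    (le_of_eq (by congr 1; ring))
  refine (ballDensity_iUnion_ball_le hδ0 hδn (y k) (r k) x hs univ fun _ _ => mem_univ _).trans ?_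
  simp only [indicator_univ]
  rw [show volume (ball (0 : EuclideanSpace ℝ (Fin n)) 1) = (V : ℝ≥0∞) from hV]
  have hSk := le_ofReal_rpow_of_tsum_le hA hS k
  have hq : 0 < A * (2 : ℝ) ^ (-k) := by positivity
  obtain ⟨q, hqdef⟩ : ∃ q, q = A * (2 : ℝ) ^ (-k) := ⟨_, rfl⟩
  rw [← hqdef] at hSk hq
  calc (V : ℝ≥0∞) * ((∑' j, (r k j : ℝ≥0∞) ^ δ) ^ (1 / δ) / ENNReal.ofReal s) ^ (n : ℝ)
      ≤ (V : ℝ≥0∞) * (ENNReal.ofReal (q ^ p) ^ (1 / δ) / ENNReal.ofReal s) ^ (n : ℝ) := by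
        gcongr
    _ = ENNReal.ofReal (V * ((q ^ p) ^ (1 / δ) / s) ^ (n : ℝ)) := by
        rw [ENNReal.ofReal_mul (by positivity), ENNReal.ofReal_coe_nnreal,
          ENNReal.ofReal_rpow_of_pos (by positivity), ← ENNReal.ofReal_div_of_pos hs,
          ENNReal.ofReal_rpow_of_pos (by positivity)]
    _ = _ := by
        congr 1
        rw [show (V : ℝ) ^ (δ / (p * n)) * (A * s ^ (-(δ / p))) * 2 ^ (-k) =
          (V : ℝ) ^ (δ / (p * n)) * (q * s ^ (-(δ / p))) by rw [hqdef]; ring,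
          Real.mul_rpow (by positivity) (by positivity), Real.mul_rpow (by positivity)
          (by positivity), Real.div_rpow (by positivity) hs.le, ← Real.rpow_mul (by positivity),
          ← Real.rpow_mul (by positivity), ← Real.rpow_mul (by positivity),
          ← Real.rpow_mul (by positivity),
          show δ / (p * n) * (p * n / δ) = 1 by field_simp,
          show -(δ / p) * (p * n / δ) = -(n : ℝ) by field_simp,
          show p * (1 / δ * n) = p * n / δ by ring, Real.rpow_one, Real.rpow_neg hs.le,
          div_eq_mul_inv]

theorem tsum_geometric_mul_rpow_ne_top {σ τ : ℝ} (hσ : 0 < σ) (hτ : τ < σ) {K L : ℝ≥0∞}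
    (hK : K ≠ ∞) (hL : L ≠ ∞) :
    ∑' m : ℕ, ENNReal.ofReal (((2 : ℝ) ^ (-σ)) ^ m) *
      (K + L * (((1 / 2 : ℝ≥0) ^ (m + 1) : ℝ≥0) : ℝ≥0∞) ^ (-τ)) ≠ ∞ := by
  have hgeom : ∀ x : ℝ, 0 ≤ x → x < 1 → ∑' m : ℕ, ENNReal.ofReal (x ^ m) ≠ ∞ := fun x h0 h1 => by
    rw [← ENNReal.ofReal_tsum_of_nonneg (fun m => pow_nonneg h0 m)
      (summable_geometric_of_lt_one h0 h1)]
    exact ENNReal.ofReal_ne_top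
  have h1 : (2 : ℝ) ^ (-σ) < 1 := Real.rpow_lt_one_of_one_lt_of_neg one_lt_two (by linarith)
  have h2 : (2 : ℝ) ^ (τ - σ) < 1 := Real.rpow_lt_one_of_one_lt_of_neg one_lt_two (by linarith)
  have hterm : ∀ m : ℕ, ENNReal.ofReal (((2 : ℝ) ^ (-σ)) ^ m) *
      (K + L * (((1 / 2 : ℝ≥0) ^ (m + 1) : ℝ≥0) : ℝ≥0∞) ^ (-τ)) =
      ENNReal.ofReal (((2 : ℝ) ^ (-σ)) ^ m) * K +
        ENNReal.ofReal (((2 : ℝ) ^ (τ - σ)) ^ m) * (L * ENNReal.ofReal (2 ^ τ)) := by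
    intro m
    have hpow : (((1 / 2 : ℝ≥0) ^ (m + 1) : ℝ≥0) : ℝ≥0∞) ^ (-τ) =
        ENNReal.ofReal (((1 / 2 : ℝ) ^ (m + 1)) ^ (-τ)) := by
      rw [← ENNReal.ofReal_rpow_of_pos (by positivity), ← ENNReal.ofReal_coe_nnreal]
      congr 2
    have hreal : ((2 : ℝ) ^ (-σ)) ^ m * ((1 / 2 : ℝ) ^ (m + 1)) ^ (-τ) =
        ((2 : ℝ) ^ (τ - σ)) ^ m * 2 ^ τ := by
      rw [one_div, inv_pow, Real.inv_rpow (by positivity), ← Real.rpow_neg (by positivity), neg_neg,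
        ← Real.rpow_natCast, ← Real.rpow_natCast, ← Real.rpow_natCast, ← Real.rpow_mul two_pos.le,
        ← Real.rpow_mul two_pos.le, ← Real.rpow_mul two_pos.le, ← Real.rpow_add two_pos,
        ← Real.rpow_add two_pos]
      congr 1
      push_cast
      ring
    rw [mul_add, hpow, mul_left_comm, ← ENNReal.ofReal_mul (by positivity), hreal,
      ENNReal.ofReal_mul (by positivity)]
    ring
  simp_rw [hterm]
  rw [ENNReal.tsum_add, ENNReal.tsum_mul_right, ENNReal.tsum_mul_right]
  exact ENNReal.add_ne_top.2 ⟨ENNReal.mul_ne_top (hgeom _ (by positivity) h1) hK,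
    ENNReal.mul_ne_top (hgeom _ (by positivity) h2) (ENNReal.mul_ne_top hL ENNReal.ofReal_ne_top)⟩

theorem exists_cover_of_lt_tsum_ballDensity {n : ℕ} {δ κ p : ℝ} (hδ0 : 0 < δ) (hδn : δ ≤ n)
    (hκ0 : 0 ≤ κ) (hκp : κ * p < δ) (hp : δ / n < p) :
    ∃ C : ℝ≥0, 0 < C ∧ ∀ A : ℝ, 0 < A → ∀ (y : ℤ → ℕ → EuclideanSpace ℝ (Fin n)) (r : ℤ → ℕ → ℝ≥0),
      ∑' k : ℤ, ENNReal.ofReal (((2 : ℝ) ^ p) ^ k) * ∑' j, (r k j : ℝ≥0∞) ^ δ ≤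
        ENNReal.ofReal (A ^ p) →
      ∃ (ι : Type) (_ : Countable ι) (z : ι → EuclideanSpace ℝ (Fin n)) (ρ : ι → ℝ≥0) (D : ι → ℝ),
        (∀ i, 0 ≤ D i) ∧
        ∑' i, ENNReal.ofReal (D i ^ p) * (ρ i : ℝ≥0∞) ^ (δ - κ * p) ≤ C * ENNReal.ofReal (A ^ p) ∧
        ∀ x s T, 0 < s → 0 < T → ENNReal.ofReal (T * s ^ (-κ)) <
          ∑' k : ℤ, ENNReal.ofReal (2 ^ k) * ballDensity (⋃ j, ball (y k j) (r k j)) x s →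
          ∃ i, x ∈ ball (z i) (ρ i) ∧ T < D i := by
  have hn : (0 : ℝ) < n := hδ0.trans_le hδn
  have hp0 : 0 < p := (by positivity : 0 < δ / n).trans hp
  have hβ' : 1 < p * n / δ := by
    rw [one_lt_div hδ0]
    exact (div_lt_iff₀ hn).1 hp
  obtain ⟨β, hβ1, hβ2⟩ := exists_between hβ'
  have hβ0 : 0 < β := by linarith
  have hτσ : δ / n < p / β := by
    rw [lt_div_iff₀ hδ0] at hβ2
    rw [div_lt_div_iff₀ hn hβ0]
    linarith
  set B := ball (0 : EuclideanSpace ℝ (Fin n)) 1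
  have hV : volume B = ((volume B).toNNReal : ℝ≥0∞) :=
    (ENNReal.coe_toNNReal measure_ball_lt_top.ne).symm
  set V := (volume B).toNNReal
  have hV0 : 0 < V := ENNReal.toNNReal_pos (measure_ball_pos _ _ one_pos).ne' measure_ball_lt_top.ne
  obtain ⟨C₁, hC₁, hsum⟩ := exists_tsum_zpow_mul_le hβ1 V
  set G := ∑' m : ℕ, ENNReal.ofReal (((2 : ℝ) ^ (-(p / β))) ^ m) *
      ((2 : ℝ≥0∞) ^ δ + 10 ^ δ * (((1 / 2 : ℝ≥0) ^ (m + 1) : ℝ≥0) : ℝ≥0∞) ^ (-(δ / n))) with hG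
  have hGtop : G ≠ ∞ := tsum_geometric_mul_rpow_ne_top (by positivity) hτσ
    (ENNReal.rpow_ne_top_of_nonneg hδ0.le (by simp))
    (ENNReal.rpow_ne_top_of_nonneg hδ0.le (by simp))
  have hGC : G * ENNReal.ofReal (C₁ ^ p * (V : ℝ) ^ (p / β)) ≠ ∞ :=
    ENNReal.mul_ne_top hGtop ENNReal.ofReal_ne_top
  refine ⟨(G * ENNReal.ofReal (C₁ ^ p * (V : ℝ) ^ (p / β))).toNNReal + 1, by positivity,
    fun A hA y r hS => ?_⟩
  have hStop : ∀ k, ∑' j, (r k j : ℝ≥0∞) ^ δ ≠ ∞ := fun k =>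
    ((le_ofReal_rpow_of_tsum_le hA hS k).trans_lt ENNReal.ofReal_lt_top).ne
  choose ι hι z ρ hρ hcov using fun (k : ℤ) (m : ℕ) => exists_cover_of_lt_ballDensity hδ0 hδn (y k)
    (r k) (hStop k) (show (0 : ℝ≥0) < (1 / 2) ^ (m + 1) by positivity)
  refine ⟨Σ (k : ℤ) (m : ℕ), ι k m, inferInstance, fun i => z _ _ i.2.2, fun i => ρ _ _ i.2.2,
    fun i => C₁ * 2 ^ i.1 * (ρ _ _ i.2.2 : ℝ) ^ κ * (V * (1 / 2) ^ i.2.1) ^ (1 / β),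
    fun i => by positivity, ?_, ?_⟩
  · have hterm : ∀ (k : ℤ) (m : ℕ) (a : ι k m),
        ENNReal.ofReal ((C₁ * 2 ^ k * (ρ k m a : ℝ) ^ κ * (V * (1 / 2) ^ m) ^ (1 / β)) ^ p) *
          (ρ k m a : ℝ≥0∞) ^ (δ - κ * p) ≤
        ENNReal.ofReal (C₁ ^ p * (V : ℝ) ^ (p / β)) * (ENNReal.ofReal (((2 : ℝ) ^ p) ^ k) *
          (ENNReal.ofReal (((2 : ℝ) ^ (-(p / β))) ^ m) * (ρ k m a : ℝ≥0∞) ^ δ)) := by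
      intro k m a
      rcases eq_or_ne (ρ k m a) 0 with h0 | h0
      · rw [h0, ENNReal.coe_zero, ENNReal.zero_rpow_of_pos (by linarith), mul_zero]
        exact zero_le
      have hr : (0 : ℝ) < ρ k m a := NNReal.coe_pos.2 (pos_iff_ne_zero.2 h0)
      rw [← ENNReal.ofReal_coe_nnreal, ENNReal.ofReal_rpow_of_pos hr, ENNReal.ofReal_rpow_of_pos hr,
        ← ENNReal.ofReal_mul (by positivity), ← ENNReal.ofReal_mul (by positivity),
        ← ENNReal.ofReal_mul (by positivity), ← ENNReal.ofReal_mul (by positivity)]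
      refine ENNReal.ofReal_le_ofReal (le_of_eq ?_)
      have e1 : ((2 : ℝ) ^ p) ^ k = ((2 : ℝ) ^ k) ^ p := by
        rw [← Real.rpow_intCast, ← Real.rpow_intCast, ← Real.rpow_mul two_pos.le,
          ← Real.rpow_mul two_pos.le, mul_comm]
      have e2 : ((2 : ℝ) ^ (-(p / β))) ^ m = ((1 / 2 : ℝ) ^ m) ^ (p / β) := by
        rw [one_div, inv_pow, Real.inv_rpow (by positivity), ← Real.rpow_neg (by positivity),
          ← Real.rpow_natCast, ← Real.rpow_natCast, ← Real.rpow_mul two_pos.le,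
          ← Real.rpow_mul two_pos.le, mul_comm]
      rw [Real.mul_rpow (by positivity) (by positivity), Real.mul_rpow (by positivity)
        (by positivity), Real.mul_rpow (by positivity) (by positivity),
        ← Real.rpow_mul (by positivity), ← Real.rpow_mul (by positivity), one_div_mul_eq_div,
        Real.mul_rpow (by positivity) (by positivity), e1, e2, Real.rpow_sub hr]
      field_simp
    have hC : (((G * ENNReal.ofReal (C₁ ^ p * (V : ℝ) ^ (p / β))).toNNReal + 1 : ℝ≥0) : ℝ≥0∞) =
        G * ENNReal.ofReal (C₁ ^ p * (V : ℝ) ^ (p / β)) + 1 := by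
      rw [ENNReal.coe_add, ENNReal.coe_toNNReal hGC, ENNReal.coe_one]
    rw [hC, ENNReal.tsum_sigma']
    simp only [ENNReal.tsum_sigma']
    calc _ ≤ ∑' (k : ℤ) (m : ℕ) (a : ι k m), ENNReal.ofReal (C₁ ^ p * (V : ℝ) ^ (p / β)) *
          (ENNReal.ofReal (((2 : ℝ) ^ p) ^ k) *
            (ENNReal.ofReal (((2 : ℝ) ^ (-(p / β))) ^ m) * (ρ k m a : ℝ≥0∞) ^ δ)) :=
          ENNReal.tsum_le_tsum fun k => ENNReal.tsum_le_tsum fun m => ENNReal.tsum_le_tsum fun a =>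
            hterm k m a
      _ = ENNReal.ofReal (C₁ ^ p * (V : ℝ) ^ (p / β)) * ∑' k : ℤ,
          ENNReal.ofReal (((2 : ℝ) ^ p) ^ k) * ∑' m : ℕ,
            ENNReal.ofReal (((2 : ℝ) ^ (-(p / β))) ^ m) * ∑' a : ι k m, (ρ k m a : ℝ≥0∞) ^ δ := by
          simp only [ENNReal.tsum_mul_left]
      _ ≤ ENNReal.ofReal (C₁ ^ p * (V : ℝ) ^ (p / β)) * ∑' k : ℤ,
          ENNReal.ofReal (((2 : ℝ) ^ p) ^ k) * (G * ∑' j, (r k j : ℝ≥0∞) ^ δ) := by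
          gcongr with k
          rw [hG, ← ENNReal.tsum_mul_right]
          refine ENNReal.tsum_le_tsum fun m => ?_
          rw [mul_assoc]
          exact mul_le_mul_right (hρ k m) _
      _ = G * ENNReal.ofReal (C₁ ^ p * (V : ℝ) ^ (p / β)) * ∑' k : ℤ,
          ENNReal.ofReal (((2 : ℝ) ^ p) ^ k) * ∑' j, (r k j : ℝ≥0∞) ^ δ := by
          simp only [mul_left_comm _ G, ENNReal.tsum_mul_left]
          ring
      _ ≤ _ := mul_le_mul' le_self_add hS
  · intro x s T hs hT hlt
    have hb : 0 < T * s ^ (-κ) / C₁ := by positivity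
    have hex : ∃ k : ℤ, ENNReal.ofReal ((T * s ^ (-κ) / C₁ * 2 ^ (-k)) ^ β) <
        ballDensity (⋃ j, ball (y k j) (r k j)) x s := by
      by_contra! hcon
      have := hsum _ hb _ (fun k => (ballDensity_le _ x s).trans hV.le) hcon
      rw [mul_div_cancel₀ _ hC₁.ne'] at this
      exact absurd hlt this.not_gt
    obtain ⟨k, hk⟩ := hex
    obtain ⟨W, hWdef⟩ : ∃ W, W = ballDensity (⋃ j, ball (y k j) (r k j)) x s := ⟨_, rfl⟩
    rw [← hWdef] at hk
    have hWV : W ≤ V := hWdef ▸ (ballDensity_le _ x s).trans hV.le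
    have hWtop : W ≠ ∞ := (hWV.trans_lt ENNReal.coe_lt_top).ne
    lift W to ℝ≥0 using hWtop with w
    have hw0 : 0 < w := by
      rw [← ENNReal.coe_pos]
      exact zero_le.trans_lt hk
    have hwV : w ≤ V := by exact_mod_cast hWV
    obtain ⟨m, hm1, hm2⟩ := exists_nat_pow_near_of_lt_one (x := w / V) (y := (1 / 2 : ℝ≥0))
      (by positivity) ((div_le_one₀ hV0).2 hwV) (by positivity) (by
        rw [← NNReal.coe_lt_coe]; norm_num)
    rw [lt_div_iff₀ hV0] at hm1
    rw [div_le_iff₀ hV0] at hm2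
    obtain ⟨a, hxa, hsa⟩ := hcov k m x s hs (by
      rw [show volume (ball (0 : EuclideanSpace ℝ (Fin n)) 1) = (V : ℝ≥0∞) from hV,
        ← hWdef, mul_comm]
      exact_mod_cast hm1)
    refine ⟨⟨k, m, a⟩, hxa, ?_⟩
    have h1 : (T * s ^ (-κ) / C₁ * 2 ^ (-k)) ^ β < V * (1 / 2) ^ m := by
      rw [← ENNReal.ofReal_coe_nnreal, ENNReal.ofReal_lt_ofReal_iff (by exact_mod_cast hw0)] at hk
      refine hk.trans_le ?_
      rw [mul_comm]
      exact_mod_cast hm2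
    have h2 : T * s ^ (-κ) / C₁ * 2 ^ (-k) < (V * (1 / 2) ^ m) ^ (1 / β) := by
      have := Real.rpow_lt_rpow (by positivity) h1 (show 0 < 1 / β by positivity)
      rwa [← Real.rpow_mul (by positivity), mul_one_div_cancel hβ0.ne', Real.rpow_one] at this
    have h3 : T < C₁ * 2 ^ k * s ^ κ * (V * (1 / 2) ^ m) ^ (1 / β) := by
      have h4 : T = C₁ * 2 ^ k * s ^ κ * (T * s ^ (-κ) / C₁ * 2 ^ (-k)) := by
        rw [Real.rpow_neg hs.le, zpow_neg]
        field_simp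
      rw [h4]
      exact mul_lt_mul_of_pos_left h2 (by positivity)
    refine h3.trans_le ?_
    have : s ^ κ ≤ (ρ k m a : ℝ) ^ κ := Real.rpow_le_rpow hs.le hsa hκ0
    gcongr

theorem exists_choquet_rpow_le {n : ℕ} {δ κ p : ℝ} (hδ0 : 0 < δ) (hδn : δ ≤ n) (hκ0 : 0 ≤ κ)
    (hκ1 : κ < 1) (hp1 : δ / n < p) (hp2 : p < δ) :
    ∃ C : ℝ, 0 < C ∧ ∀ A : ℝ, 0 < A → ∀ (y : ℤ → ℕ → EuclideanSpace ℝ (Fin n)) (r : ℤ → ℕ → ℝ≥0),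
      ∑' k : ℤ, ENNReal.ofReal (((2 : ℝ) ^ p) ^ k) * ∑' j, (r k j : ℝ≥0∞) ^ δ ≤
        ENNReal.ofReal (A ^ p) →
      ∀ u : EuclideanSpace ℝ (Fin n) → ℝ, ContDiff ℝ 1 u → HasCompactSupport u →
      (∀ k : ℤ, {x | (2 : ℝ) ^ k < ‖fderiv ℝ u x‖} ⊆ ⋃ j, ball (y k j) (r k j)) →
      ∀ Ω : Set (EuclideanSpace ℝ (Fin n)),
      (choquet n (δ - κ * p) Ω fun x => |u x| ^ (p * (δ - κ * p) / (δ - p))) ≤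
        ENNReal.ofReal (C * A ^ (p * (δ - κ * p) / (δ - p))) := by
  have hn : (0 : ℝ) < n := hδ0.trans_le hδn
  have hp0 : 0 < p := (by positivity : 0 < δ / n).trans hp1
  have hκp : κ * p < δ := by nlinarith
  have hδp : 0 < δ - p := by linarith
  obtain ⟨d, hddef⟩ : ∃ d, d = δ - κ * p := ⟨_, rfl⟩
  have hd : 0 < d := by linarith
  obtain ⟨q, hqdef⟩ : ∃ q, q = p * d / (δ - p) := ⟨_, rfl⟩
  have hq : 0 < q := by rw [hqdef]; positivity
  obtain ⟨e, hedef⟩ : ∃ e, e = δ / p := ⟨_, rfl⟩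
  have he : 1 < e := by rwa [hedef, one_lt_div hp0]
  have hqe : (e - 1) * q = d := by
    rw [hqdef, hedef]
    field_simp
  have hpe : (e - κ) * p = d := by
    rw [hddef, hedef]
    field_simp
  have hκe : 0 < 1 - κ := by linarith
  have he1 : 0 < e - 1 := by linarith
  obtain ⟨C₁, hC₁, htail⟩ := exists_tsum_ballDensity_le hδ0 hδn hp1
  obtain ⟨C₂, hC₂, hcover⟩ := exists_cover_of_lt_tsum_ballDensity hδ0 hδn hκ0 hκp hp1
  set B := ball (0 : EuclideanSpace ℝ (Fin n)) 1
  have hV : volume B = ENNReal.ofReal (volume B).toReal :=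
    (ENNReal.ofReal_toReal measure_ball_lt_top.ne).symm
  set V := (volume B).toReal
  have hV0 : 0 < V := ENNReal.toReal_pos (measure_ball_pos _ _ one_pos).ne' measure_ball_lt_top.ne
  obtain ⟨C₃, hC₃def⟩ : ∃ C₃, C₃ = (1 / (1 - κ) + C₁ / (e - 1)) / V := ⟨_, rfl⟩
  have hC₃ : 0 < C₃ := by rw [hC₃def]; positivity
  refine ⟨C₂ * C₃ ^ q, by positivity, fun A hA y r hS u hu hc hE Ω => ?_⟩
  rw [← hddef, ← hqdef]
  obtain ⟨ι, _, z, ρ, D, hD0, hsum, hcov⟩ := hcover A hA y r hS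
  rw [← hddef] at hsum
  obtain ⟨M, hMdef⟩ : ∃ M, M = (C₃ * A) ^ q := ⟨_, rfl⟩
  have hM : 0 < M := by rw [hMdef]; positivity
  calc choquet n d Ω (fun x => |u x| ^ q)
      ≤ ∑' i, ENNReal.ofReal (D i ^ p * (M / A ^ p)) * (ρ i : ℝ≥0∞) ^ d := by
        refine lintegral_hContent_le_tsum hd _ z ρ _ fun t ht x hx => ?_
        have hx2 : t < |u x| ^ q := hx.2
        simp only [mem_iUnion, exists_prop]
        by_contra! hcon
        have htM : 0 < t / M := by positivity
        obtain ⟨R, hRdef⟩ : ∃ R, R = (t / M) ^ (-(1 / d)) := ⟨_, rfl⟩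
        have hR : 0 < R := by rw [hRdef]; positivity
        have hsmall : ∀ s, 0 < s → ∑' k : ℤ, ENNReal.ofReal (2 ^ k) *
            ballDensity (⋃ j, ball (y k j) (r k j)) x s ≤
              ENNReal.ofReal (A * R ^ (κ - e) * s ^ (-κ)) := by
          intro s hs
          by_contra! hlt
          obtain ⟨i, hxi, hi⟩ := hcov x s (A * R ^ (κ - e)) hs (by positivity) hlt
          refine hcon i ?_ hxi
          have h1 := Real.rpow_lt_rpow (by positivity) hi hp0
          have h2 : (A * R ^ (κ - e)) ^ p = A ^ p * (t / M) := by
            rw [Real.mul_rpow hA.le (by positivity), hRdef, ← Real.rpow_mul htM.le,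
              ← Real.rpow_mul htM.le, show -(1 / d) * (κ - e) * p = (e - κ) * p / d by ring, hpe,
              div_self hd.ne', Real.rpow_one]
          rw [h2] at h1
          calc t = A ^ p * (t / M) * (M / A ^ p) := by field_simp
            _ < D i ^ p * (M / A ^ p) := mul_lt_mul_of_pos_right h1 (by positivity)
        have hint := (volume_unitBall_mul_enorm_le (by exact_mod_cast hn) hu hc x).trans
          ((lintegral_mono fun s => lintegral_unitBall_le_tsum_ballDensity (fderiv ℝ u) _
            (fun k => isOpen_iUnion fun j => isOpen_ball) hE x s).trans
            (lintegral_le_of_le_rpow hκ1 he hA.le hC₁.le hR hsmall fun s hs => by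
              rw [hedef]; exact htail A hA y r hS x s hs))
        rw [show volume (ball (0 : EuclideanSpace ℝ (Fin n)) 1) = ENNReal.ofReal V from hV,
          ← ofReal_norm, ← ENNReal.ofReal_mul hV0.le,
          ENNReal.ofReal_le_ofReal_iff (by positivity), Real.norm_eq_abs] at hint
        have hux : |u x| ≤ C₃ * A * R ^ (1 - e) := by
          rw [hC₃def, div_mul_eq_mul_div, div_mul_eq_mul_div, le_div_iff₀ hV0, mul_comm]
          exact hint
        refine hx2.not_ge ((Real.rpow_le_rpow (abs_nonneg _) hux hq.le).trans (le_of_eq ?_))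
        rw [Real.mul_rpow (by positivity) (by positivity), ← hMdef, hRdef,
          ← Real.rpow_mul htM.le, ← Real.rpow_mul htM.le,
          show -(1 / d) * (1 - e) * q = (e - 1) * q / d by ring, hqe, div_self hd.ne',
          Real.rpow_one]
        field_simp
    _ = ENNReal.ofReal (M / A ^ p) * ∑' i, ENNReal.ofReal (D i ^ p) * (ρ i : ℝ≥0∞) ^ d := by
        rw [← ENNReal.tsum_mul_left]
        refine tsum_congr fun i => ?_
        rw [ENNReal.ofReal_mul (Real.rpow_nonneg (hD0 i) _)]
        ring
    _ ≤ ENNReal.ofReal (M / A ^ p) * (C₂ * ENNReal.ofReal (A ^ p)) := mul_le_mul_right hsum _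
    _ = ENNReal.ofReal (C₂ * C₃ ^ q * A ^ q) := by
        rw [← ENNReal.ofReal_coe_nnreal, ← ENNReal.ofReal_mul (by positivity),
          ← ENNReal.ofReal_mul (by positivity), hMdef, Real.mul_rpow hC₃.le hA.le]
        congr 1
        field_simp

/-- Optimal covers of countably many level sets, with an error that is small after weighting. -/
theorem exists_covers_of_tsum_hContent_lt {n : ℕ} {d : ℝ} {w : ℤ → ℝ≥0∞} (hw0 : ∀ k, w k ≠ 0)
    (hwtop : ∀ k, w k ≠ ∞) (E : ℤ → Set (EuclideanSpace ℝ (Fin n))) {a : ℝ≥0∞}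
    (h : ∑' k, w k * hContent n d (E k) < a) :
    ∃ (y : ℤ → ℕ → EuclideanSpace ℝ (Fin n)) (r : ℤ → ℕ → ℝ≥0),
      (∀ k, E k ⊆ ⋃ j, ball (y k j) (r k j)) ∧
      ∑' k, w k * ∑' j, (r k j : ℝ≥0∞) ^ d ≤ a := by
  obtain ⟨ε, hε0, hε⟩ := ENNReal.exists_pos_sum_of_countable' (tsub_pos_of_lt h).ne' ℤ
  have hfin : ∀ k, hContent n d (E k) ≠ ∞ := fun k hk => by
    refine (((ENNReal.le_tsum k).trans_lt h).trans_le le_top).ne ?_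
    rw [hk, ENNReal.mul_top (hw0 k)]
  choose y r hE hr using fun k => exists_cover_of_hContent_lt
    (ENNReal.lt_add_right (hfin k) (ENNReal.div_pos (hε0 k).ne' (hwtop k)).ne')
  refine ⟨y, r, hE, ?_⟩
  calc ∑' k, w k * ∑' j, (r k j : ℝ≥0∞) ^ d
      ≤ ∑' k, (w k * hContent n d (E k) + ε k) := by
        refine ENNReal.tsum_le_tsum fun k => (mul_le_mul_right (hr k).le _).trans (le_of_eq ?_)
        rw [mul_add, ENNReal.mul_div_cancel (hw0 k) (hwtop k)]
    _ ≤ ∑' k, w k * hContent n d (E k) + (a - ∑' k, w k * hContent n d (E k)) := by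
        rw [ENNReal.tsum_add]
        gcongr
    _ = a := add_tsub_cancel_of_le h.le

/-- fractional Poincaré–Sobolev inequality for `C¹₀`-functions w.r.t. Hausdorff
contents, valid also in unbounded domains. For `0 < δ ≤ n`, `0 ≤ κ < 1`, `δ/n < p < δ` there is
`c = c(n, δ, κ, p)` such that for every domain `Ω ⊆ ℝⁿ` and every `u ∈ C¹₀(Ω)`,
`(∫_Ω |u|^{p(δ-κp)/(δ-p)} dH^{δ-κp}_∞)^{(δ-p)/(p(δ-κp))} ≤ c (∫_Ω |∇u|^p dH^δ_∞)^{1/p}`. -/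
theorem fractional_sobolev_compact_support_content (n : ℕ) (hn : 2 ≤ n) (δ κ p : ℝ)
    (hδ0 : 0 < δ) (hδn : δ ≤ (n : ℝ)) (hκ0 : 0 ≤ κ) (hκ1 : κ < 1)
    (hp1 : δ / n < p) (hp2 : p < δ) :
    ∃ c : ℝ≥0, 0 < c ∧
      ∀ Ω : Set (EuclideanSpace ℝ (Fin n)), IsOpen Ω → IsConnected Ω →
        ∀ u : EuclideanSpace ℝ (Fin n) → ℝ,
          ContDiff ℝ 1 u → HasCompactSupport u → tsupport u ⊆ Ω →
          (choquet n (δ - κ * p) Ω fun x =>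
              |u x| ^ (p * (δ - κ * p) / (δ - p))) ^ ((δ - p) / (p * (δ - κ * p)))
            ≤ c * (choquet n δ Ω fun x => ‖fderiv ℝ u x‖ ^ p) ^ (1 / p) := by
  have hn0 : (0 : ℝ) < n := hδ0.trans_le hδn
  have hp0 : 0 < p := (by positivity : 0 < δ / n).trans hp1
  have hδp : 0 < δ - p := by linarith
  have hd : 0 < δ - κ * p := by nlinarith
  obtain ⟨C, hC, hmain⟩ := exists_choquet_rpow_le hδ0 hδn hκ0 hκ1 hp1 hp2
  obtain ⟨q, hqdef⟩ : ∃ q, q = p * (δ - κ * p) / (δ - p) := ⟨_, rfl⟩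
  have hq : 0 < q := by rw [hqdef]; positivity
  have hqinv : (δ - p) / (p * (δ - κ * p)) = 1 / q := by rw [hqdef, one_div_div]
  rw [← hqdef] at hmain
  rw [hqinv, ← hqdef]
  obtain ⟨K, hKdef⟩ : ∃ K : ℝ, K = 2 ^ p / (2 ^ p - 1) := ⟨_, rfl⟩
  have hK : 0 < K := by
    have : (1 : ℝ) < 2 ^ p := Real.one_lt_rpow one_lt_two hp0
    rw [hKdef]
    exact div_pos (by positivity) (by linarith)
  refine ⟨Real.toNNReal (C ^ (1 / q) * K ^ (1 / p)), Real.toNNReal_pos.2 (by positivity),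
    fun Ω _ _ u hu hc hsupp => ?_⟩
  have hlevel : ∀ k : ℤ, {x | (2 : ℝ) ^ k < ‖fderiv ℝ u x‖} ⊆
      {x ∈ Ω | (2 : ℝ) ^ k < ‖fderiv ℝ u x‖} := fun k x hx => by
    refine ⟨hsupp (support_fderiv_subset ℝ (Function.mem_support.2 fun h0 => ?_)), hx⟩
    rw [mem_ofPred_eq, h0, norm_zero] at hx
    exact absurd hx (by positivity : (0 : ℝ) < 2 ^ k).not_gt
  set X := choquet n δ Ω fun x => ‖fderiv ℝ u x‖ ^ p
  have hX : ∑' k : ℤ, ENNReal.ofReal (((2 : ℝ) ^ p) ^ k) *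
      hContent n δ {x ∈ Ω | (2 : ℝ) ^ k < ‖fderiv ℝ u x‖} ≤ ENNReal.ofReal K * X :=
    hKdef ▸ tsum_zpow_mul_hContent_le hp0 Ω fun x => ‖fderiv ℝ u x‖
  have hbound : ∀ A : ℝ, 0 < A → ENNReal.ofReal K * X < ENNReal.ofReal (A ^ p) →
      (choquet n (δ - κ * p) Ω fun x => |u x| ^ q) ^ (1 / q) ≤
        ENNReal.ofReal (C ^ (1 / q) * A) := by
    intro A hA hlt
    obtain ⟨y, r, hE, hr⟩ := exists_covers_of_tsum_hContent_lt
      (fun k => by simpa using (by positivity : 0 < ((2 : ℝ) ^ p) ^ k))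
      (fun k => ENNReal.ofReal_ne_top) _ (hX.trans_lt hlt)
    refine (ENNReal.rpow_le_rpow (hmain A hA y r hr u hu hc (fun k => (hlevel k).trans (hE k)) Ω)
      (by positivity)).trans (le_of_eq ?_)
    rw [ENNReal.ofReal_rpow_of_pos (by positivity), Real.mul_rpow hC.le (by positivity),
      ← Real.rpow_mul hA.le, mul_one_div_cancel hq.ne', Real.rpow_one]
  have hfinal : ENNReal.ofReal (C ^ (1 / q)) * (ENNReal.ofReal K * X) ^ (1 / p) =
      (Real.toNNReal (C ^ (1 / q) * K ^ (1 / p)) : ℝ≥0∞) * X ^ (1 / p) := by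
    rw [ENNReal.mul_rpow_of_nonneg _ _ (by positivity), ENNReal.ofReal_rpow_of_pos hK, ← mul_assoc,
      ← ENNReal.ofReal_mul (by positivity)]
    rfl
  rw [← hfinal]
  have hC' : ENNReal.ofReal (C ^ (1 / q)) ≠ 0 := by
    simpa using (by positivity : 0 < C ^ (1 / q))
  rw [mul_comm (ENNReal.ofReal _), ← ENNReal.div_le_iff hC' ENNReal.ofReal_ne_top]
  refine le_of_forall_gt_imp_ge_of_dense fun b hb => ?_
  rcases eq_or_ne b ∞ with rfl | hbtop
  · exact le_top
  have hb0 : 0 < b.toReal := ENNReal.toReal_pos (zero_le.trans_lt hb).ne' hbtop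
  rw [ENNReal.div_le_iff hC' ENNReal.ofReal_ne_top]
  refine (hbound b.toReal hb0 ?_).trans (le_of_eq ?_)
  · rw [← ENNReal.ofReal_rpow_of_pos hb0, ENNReal.ofReal_toReal hbtop]
    have := ENNReal.rpow_lt_rpow hb hp0
    rwa [← ENNReal.rpow_mul, one_div_mul_cancel hp0.ne', ENNReal.rpow_one] at this
  · rw [ENNReal.ofReal_mul (by positivity), ENNReal.ofReal_toReal hbtop, mul_comm]
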